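/- arXiv:2105.00975 — 2 statements merged into one kernel-verified Lean document; each statement's English description precedes it below -/
import Mathlib

section
/- Let p be a prime with p ≡ 7 (mod 8), and suppose there exists a Hadamard matrix of order (p+1)/2. Then there exist p(p+1)/2 orthogonal projections P_1, ..., P_{p(p+1)/2} ∈ M_p(ℂ) with real entries, each of rank (p−1)/2, such that tr(P_i P_j) = (p² − 5)/(4(p+2)) for all i ≠ j, and the P_i span the symmetric subspace S_p of M_p(ℂ). -/
open Matrix

/-- The symmetric subspace `S_d` of `M_d(ℂ)`: matrices `A` with `Aᵀ = A`. -/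
noncomputable def symMatrices (d : ℕ) : Submodule ℂ (Matrix (Fin d) (Fin d) ℂ) where
  carrier := {A : Matrix (Fin d) (Fin d) ℂ | Aᵀ = A}
  add_mem' := by
    intro a b ha hb
    simp only [Set.mem_setOf_eq, Matrix.transpose_add] at *
    rw [ha, hb]
  zero_mem' := by simp
  smul_mem' := by
    intro c A hA
    simp only [Set.mem_setOf_eq, Matrix.transpose_smul] at *
    rw [hA]

open Finset in
/-- The Gram matrix argument for equiangular families: matrices with pairwise trace products `t`
and trace squares `a > t ≥ 0` are linearly independent. -/
theorem linearIndependent_of_trace_mul_eq {ι n : Type*} [Fintype ι] [DecidableEq ι] [Fintype n]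
    (P : ι → Matrix n n ℝ) {a t : ℝ} (ht : 0 ≤ t) (hat : t < a)
    (hP : ∀ i j, (P i * P j).trace = if i = j then a else t) :
    LinearIndependent ℂ fun i => (P i).map Complex.ofReal := by
  rw [Fintype.linearIndependent_iff]
  intro g hg
  have hP' : ∀ i j, ((P i).map Complex.ofReal * (P j).map Complex.ofReal).trace =
      t + if i = j then ((a - t : ℝ) : ℂ) else 0 := by
    intro i j
    have h1 : (P i).map Complex.ofReal * (P j).map Complex.ofReal =
        (P i * P j).map Complex.ofReal :=
      (Matrix.map_mul (f := Complex.ofRealHom)).symm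
    have h2 : ((P i * P j).map Complex.ofReal).trace = (((P i * P j).trace : ℝ) : ℂ) := by
      simp [Matrix.trace]
    rw [h1, h2, hP]
    split_ifs <;> simp
  have key : ∀ j, (∑ i, g i) * t + g j * ((a - t : ℝ) : ℂ) = 0 := by
    intro j
    have h := congrArg (fun M => (M * (P j).map Complex.ofReal).trace) hg
    simpa [Matrix.sum_mul, Matrix.trace_sum, hP', mul_add, sum_add_distrib, ← sum_mul] using h
  have hne : ((a - t : ℝ) : ℂ) ≠ 0 := by
    exact_mod_cast (sub_pos.2 hat).ne'
  have hsum : ∑ i, g i = 0 := by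
    have h := sum_congr rfl fun j (_ : j ∈ univ) => key j
    rw [sum_add_distrib, ← sum_mul _ _ ((a - t : ℝ) : ℂ), sum_const, sum_const_zero,
      nsmul_eq_mul, card_univ] at h
    have h' : (∑ i, g i) * (((Fintype.card ι : ℝ) * t + (a - t) : ℝ) : ℂ) = 0 := by
      push_cast
      push_cast at h
      rw [← h]
      ring
    refine (mul_eq_zero.1 h').resolve_right ?_
    have : 0 < (Fintype.card ι : ℝ) * t + (a - t) := by
      have := sub_pos.2 hat
      positivity
    exact_mod_cast this.ne'
  intro j
  have h := key j
  rw [hsum, zero_mul, zero_add] at h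
  exact (mul_eq_zero.1 h).resolve_right hne

theorem finrank_symMatrices_le (d : ℕ) :
    Module.finrank ℂ (symMatrices d) ≤ (d + 1).choose 2 := by
  let f : (Sym2 (Fin d) → ℂ) →ₗ[ℂ] Matrix (Fin d) (Fin d) ℂ :=
    { toFun := fun g => Matrix.of fun i j => g s(i, j)
      map_add' := fun _ _ => rfl
      map_smul' := fun _ _ => rfl }
  have hle : symMatrices d ≤ LinearMap.range f := by
    intro A hA
    have hA' : Aᵀ = A := hA
    exact ⟨Sym2.lift ⟨fun i j => A i j, fun i j => congrFun (congrFun hA' j) i⟩, rfl⟩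
  calc Module.finrank ℂ (symMatrices d) ≤ Module.finrank ℂ (LinearMap.range f) :=
        Submodule.finrank_mono hle
    _ ≤ Module.finrank ℂ (Sym2 (Fin d) → ℂ) := LinearMap.finrank_range_le f
    _ = (d + 1).choose 2 := by
        rw [Module.finrank_fintype_fun_eq_card, Sym2.card, Fintype.card_fin]

theorem IsIdempotentElem.trace_eq_rank {n : Type*} [Fintype n] [DecidableEq n]
    {A : Matrix n n ℝ} (hA : IsIdempotentElem A) : A.trace = A.rank := by
  have h : IsIdempotentElem (Matrix.toLin' A) := by
    rw [IsIdempotentElem, Module.End.mul_eq_comp, ← Matrix.toLin'_mul, hA.eq]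
  rw [← Matrix.trace_toLin'_eq, (LinearMap.IsIdempotentElem.isProj_range _ h).trace]
  rfl

section ReflectionMatrix

open Finset

variable {F : Type*} [Field F] [DecidableEq F]

/-- The matrix supported on the diagonal and on the graph of the reflection `k ↦ 2s - k`, with
entries `d (k - s)` and `e (k - s)` there. -/
def reflectionMatrix (d e : F → ℝ) (s : F) : Matrix F F ℝ :=
  Matrix.of fun k l => (if l = k then d (k - s) else 0) + if l = 2 * s - k then e (k - s) else 0

variable {d e d' e' : F → ℝ}

theorem reflectionMatrix_transpose (he : ∀ k, e (-k) = e k) (s : F) :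
    (reflectionMatrix d e s)ᵀ = reflectionMatrix d e s := by
  ext k l
  simp only [reflectionMatrix, Matrix.transpose_apply, Matrix.of_apply]
  congr 1
  · by_cases h : l = k
    · simp [h]
    · simp [h, Ne.symm h]
  · by_cases h : l = 2 * s - k
    · have h' : k = 2 * s - l := by rw [h]; ring
      rw [if_pos h, if_pos h', ← he]
      congr 1
      rw [h]; ring
    · have h' : ¬ k = 2 * s - l := fun h' => h (by rw [h']; ring)
      rw [if_neg h, if_neg h']

variable [Fintype F]

theorem reflectionMatrix_mul_self (he : ∀ k, e (-k) = e k)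
    (hd : ∀ k, d k ^ 2 + e k ^ 2 = d k) (hde : ∀ k, e k * (d k + d (-k)) = e k) (s : F) :
    reflectionMatrix d e s * reflectionMatrix d e s = reflectionMatrix d e s := by
  ext k l
  have h1 : 2 * s - (2 * s - k) = k := by ring
  have h2 : 2 * s - k - s = -(k - s) := by ring
  simp only [reflectionMatrix, Matrix.mul_apply, Matrix.of_apply, add_mul, sum_add_distrib,
    ite_mul, zero_mul, sum_ite_eq', mem_univ, if_true, h1, h2, he]
  have h3 := hd (k - s)
  have h4 := hde (k - s)
  split_ifs
  · linear_combination h3 + h4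
  · linear_combination h3
  · linear_combination h4
  · ring

theorem trace_reflectionMatrix (h2 : (2 : F) ≠ 0) (he : e 0 = 0) (s : F) :
    (reflectionMatrix d e s).trace = ∑ k, d k := by
  rw [← Equiv.sum_comp (Equiv.subRight s) d, Matrix.trace]
  refine sum_congr rfl fun k _ => ?_
  simp only [reflectionMatrix, Matrix.diag_apply, Matrix.of_apply, if_true, Equiv.subRight_apply,
    add_eq_left, ite_eq_right_iff]
  intro h
  have : k = s := mul_left_cancel₀ h2 (by linear_combination h)
  rw [this, sub_self, he]

theorem trace_reflectionMatrix_mul (h2 : (2 : F) ≠ 0) (he : e 0 = 0) (he' : e' 0 = 0)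
    (hee : ∀ k, e' (-k) = e' k) (s t : F) :
    (reflectionMatrix d e s * reflectionMatrix d' e' t).trace =
      ∑ k, d (k - s) * d' (k - t) + if s = t then ∑ k, e k * e' k else 0 := by
  have h3 : (if s = t then ∑ k, e k * e' k else 0) =
      ∑ k, if s = t then e (k - s) * e' (k - s) else 0 := by
    split_ifs
    · exact (Equiv.sum_comp (Equiv.subRight s) fun k => e k * e' k).symm
    · simp
  rw [h3, ← sum_add_distrib, Matrix.trace]
  refine sum_congr rfl fun k _ => ?_
  simp only [reflectionMatrix, Matrix.diag_apply, Matrix.mul_apply, Matrix.of_apply, add_mul,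
    sum_add_distrib, ite_mul, zero_mul, sum_ite_eq', mem_univ, if_true]
  have hs : ∀ {x : F}, k = 2 * x - k → k = x := fun {x} h =>
    mul_left_cancel₀ h2 (by linear_combination h)
  have hA : (if k = 2 * t - k then e' (k - t) else 0) = 0 := by
    rw [ite_eq_right_iff]
    intro h
    rw [← hs h, sub_self, he']
  have hB : e (k - s) * (if k = 2 * s - k then d' (2 * s - k - t) else 0) = 0 := by
    split_ifs with h
    · rw [← hs h, sub_self, he, zero_mul]
    · rw [mul_zero]
  have hC : (if k = 2 * t - (2 * s - k) then e' (2 * s - k - t) else 0) =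
      if s = t then e' (k - s) else 0 := by
    by_cases h : s = t
    · subst h
      rw [if_pos (by ring), if_pos rfl, ← hee]
      congr 1
      ring
    · rw [if_neg h, if_neg]
      intro h'
      exact h (mul_left_cancel₀ h2 (by linear_combination h'))
  rw [hA, mul_add, mul_add, hB, hC, mul_ite, mul_zero, mul_zero]
  ring

end ReflectionMatrix

section QuadraticChar

open Finset

variable {F : Type*} [Field F] [DecidableEq F] [Fintype F]

theorem sum_quadraticChar_mul_quadraticChar_sub (hF : ringChar F ≠ 2) {s : F} (hs : s ≠ 0) :
    ∑ k, quadraticChar F k * quadraticChar F (k - s) = -1 := by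
  have hJ := jacobiSum_nontrivial_inv (quadraticChar_ne_one hF)
  rw [(quadraticChar_isQuadratic (F := F)).inv, jacobiSum] at hJ
  have hneg : quadraticChar F (-1) ^ 2 = 1 := quadraticChar_sq_one (neg_ne_zero.2 one_ne_zero)
  rw [← Equiv.sum_comp (Equiv.mulLeft₀ s hs)]
  calc _ = ∑ x, quadraticChar F (-1) * (quadraticChar F x * quadraticChar F (1 - x)) := by
        refine sum_congr rfl fun x _ => ?_
        have h : s * x - s = s * (-1 * (1 - x)) := by ring
        simp only [Equiv.mulLeft₀_apply, h, map_mul]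
        linear_combination (quadraticChar F x * quadraticChar F (-1) * quadraticChar F (1 - x)) *
          quadraticChar_sq_one hs
    _ = -1 := by
        rw [← mul_sum, hJ]
        linear_combination -hneg

/-- The diagonal profile: `1/2 ± y` on squares and nonsquares, and `0` at `0`. -/
noncomputable def diagProfile (y : ℝ) (k : F) : ℝ :=
  if k = 0 then 0 else 1 / 2 + y * quadraticChar F k

theorem diagProfile_eq (y : ℝ) (k : F) :
    diagProfile y k = 1 / 2 - (if k = 0 then 1 / 2 else 0) + y * quadraticChar F k := by
  by_cases h : k = 0 <;> simp [diagProfile, h]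

theorem sum_diagProfile (hF : ringChar F ≠ 2) (y : ℝ) :
    ∑ k : F, diagProfile y k = ((Fintype.card F : ℝ) - 1) / 2 := by
  have h : ∑ k : F, (quadraticChar F k : ℝ) = 0 := by
    exact_mod_cast quadraticChar_sum_zero hF
  simp only [diagProfile_eq, sum_add_distrib, sum_sub_distrib, ← mul_sum, h, sum_ite_eq',
    mem_univ, if_true, sum_const, card_univ, nsmul_eq_mul]
  ring

theorem sum_diagProfile_mul_self (hF : ringChar F ≠ 2) (y : ℝ) :
    ∑ k : F, diagProfile y k * diagProfile y k =
      ((Fintype.card F : ℝ) - 1) * (1 / 4 + y ^ 2) := by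
  have h : ∑ k : F, (quadraticChar F k : ℝ) = 0 := by
    exact_mod_cast quadraticChar_sum_zero hF
  have h2 : ∀ k : F, diagProfile y k * diagProfile y k =
      (1 / 4 + y ^ 2) - (if k = 0 then 1 / 4 + y ^ 2 else 0) + y * quadraticChar F k := by
    intro k
    by_cases hk : k = 0
    · simp [diagProfile, hk]
    · have : (quadraticChar F k : ℝ) ^ 2 = 1 := by exact_mod_cast quadraticChar_sq_one hk
      simp only [diagProfile, hk, if_false]
      linear_combination y ^ 2 * this
  simp only [h2, sum_add_distrib, sum_sub_distrib, ← mul_sum, h, sum_ite_eq',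
    mem_univ, if_true, sum_const, card_univ, nsmul_eq_mul]
  ring

theorem sum_diagProfile_sub_mul (hF : ringChar F ≠ 2) (hneg : quadraticChar F (-1) = -1)
    (y : ℝ) {s t : F} (hst : s ≠ t) :
    ∑ k : F, diagProfile y (k - s) * diagProfile y (k - t) =
      ((Fintype.card F : ℝ) - 2) / 4 - y ^ 2 := by
  have h0 : ∀ u : F, ∑ k : F, (quadraticChar F (k - u) : ℝ) = 0 := by
    intro u
    refine (Equiv.sum_comp (Equiv.subRight u) fun k => (quadraticChar F k : ℝ)).trans ?_
    exact_mod_cast quadraticChar_sum_zero hF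
  have hJ : ∑ k : F, (quadraticChar F (k - s) : ℝ) * quadraticChar F (k - t) = -1 := by
    have h := sum_quadraticChar_mul_quadraticChar_sub hF (sub_ne_zero.2 hst.symm)
    rw [← Equiv.sum_comp (Equiv.subRight s)] at h
    simp only [Equiv.subRight_apply, sub_sub_sub_cancel_right] at h
    exact_mod_cast h
  have hodd : (quadraticChar F (s - t) : ℝ) + quadraticChar F (t - s) = 0 := by
    have : t - s = -1 * (s - t) := by ring
    rw [this, map_mul, hneg]
    push_cast
    ring
  have hprod : ∀ k : F, diagProfile y (k - s) * diagProfile y (k - t) =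
      1 / 4 - (if k = s then 1 / 4 + y / 2 * quadraticChar F (s - t) else 0)
        - (if k = t then 1 / 4 + y / 2 * quadraticChar F (t - s) else 0)
        + y / 2 * quadraticChar F (k - s) + y / 2 * quadraticChar F (k - t)
        + y ^ 2 * (quadraticChar F (k - s) * quadraticChar F (k - t)) := by
    intro k
    by_cases hs : k = s
    · simp [diagProfile, hs, hst]
    · by_cases ht : k = t
      · simp [diagProfile, ht, hst.symm]
      · simp only [diagProfile, sub_ne_zero.2 hs, sub_ne_zero.2 ht, hs, ht, if_false]
        ring
  simp only [hprod, sum_add_distrib, sum_sub_distrib, ← mul_sum, h0, hJ, sum_ite_eq',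
    mem_univ, if_true, sum_const, card_univ, nsmul_eq_mul]
  linear_combination (-y / 2) * hodd

end QuadraticChar

open Finset in
theorem exists_folding {p n : ℕ} [NeZero p] (hpn : p + 1 = 2 * n) :
    ∃ π : ZMod p → Fin n, (∀ k, π (-k) = π k) ∧
      ∀ f : Fin n → ℝ, ∑ k, f (π k) = 2 * ∑ r, f r - f (π 0) := by
  obtain ⟨m, rfl⟩ : ∃ m, n = m + 1 := ⟨n - 1, by have := NeZero.pos p; omega⟩
  obtain rfl : p = 2 * m + 1 := by omega
  refine ⟨fun k => ⟨k.valMinAbs.natAbs, by have := k.natAbs_valMinAbs_le; omega⟩,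
    fun k => by simp only [ZMod.natAbs_valMinAbs_neg], fun f => ?_⟩
  let g : ℕ → ℝ := fun r => if h : r < m + 1 then f ⟨r, h⟩ else 0
  have hf : ∀ r (h : r < m + 1), f ⟨r, h⟩ = g r := fun r h => by
    simp only [g]
    rw [dif_pos h]
  have hg : ∑ r, f r = ∑ r ∈ range (m + 1), g r := by
    rw [← Fin.sum_univ_eq_sum_range]
    exact sum_congr rfl fun r _ => hf r r.2
  rw [hg]
  simp only [hf, ZMod.valMinAbs_natAbs_eq_min]
  have hsum : ∑ k : ZMod (2 * m + 1), g (min k.val (2 * m + 1 - k.val)) =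
      ∑ j ∈ range (2 * m + 1), g (min j (2 * m + 1 - j)) :=
    Fin.sum_univ_eq_sum_range (fun j => g (min j (2 * m + 1 - j))) (2 * m + 1)
  have hlow : ∑ j ∈ range (m + 1), g (min j (2 * m + 1 - j)) = ∑ j ∈ range (m + 1), g j :=
    sum_congr rfl fun j hj => by
      rw [mem_range] at hj
      rw [min_eq_left (by omega)]
  have hhigh : ∑ i ∈ range m, g (min (m + 1 + i) (2 * m + 1 - (m + 1 + i))) =
      ∑ i ∈ range m, g (i + 1) := by
    rw [← sum_range_reflect]
    refine sum_congr rfl fun i hi => ?_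
    rw [mem_range] at hi
    congr 1
    omega
  rw [hsum, show 2 * m + 1 = m + 1 + m by ring, sum_range_add,
    show m + 1 + m = 2 * m + 1 by ring, hlow, hhigh, sum_range_succ' g]
  simp
  ring

section Packing

open Finset

variable {F : Type*} [Field F] [DecidableEq F] [Fintype F]

/-- A family of sign functions with the right correlations produces the packing. -/
theorem exists_equiangular_projections {ι : Type*} [DecidableEq ι]
    (hF : ringChar F ≠ 2) (hneg : quadraticChar F (-1) = -1)
    (ε : ι → F → ℝ) (hsq : ∀ i k, ε i k ^ 2 = 1) (heven : ∀ i k, ε i (-k) = ε i k)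
    (hε0 : ∀ i, ε i 0 = 1) (hcorr : ∀ i j, i ≠ j → ∑ k, ε i k * ε j k = -1) :
    ∃ P : F × ι → Matrix F F ℝ,
      (∀ i, P i * P i = P i) ∧ (∀ i, (P i)ᵀ = P i) ∧
      (∀ i, (P i).trace = ((Fintype.card F : ℝ) - 1) / 2) ∧
      ∀ i j, i ≠ j → (P i * P j).trace =
        ((Fintype.card F : ℝ) ^ 2 - 5) / (4 * ((Fintype.card F : ℝ) + 2)) := by
  set q : ℝ := (Fintype.card F : ℝ) with hq
  have hq0 : 0 ≤ q := Nat.cast_nonneg _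
  have h2 : (2 : F) ≠ 0 := Ring.two_ne_zero hF
  obtain ⟨y, hy⟩ : ∃ y : ℝ, y ^ 2 = 1 / (4 * (q + 2)) :=
    ⟨_, Real.sq_sqrt (by positivity)⟩
  have hyle : 1 / (4 * (q + 2)) ≤ 1 / 4 := by
    apply one_div_le_one_div_of_le <;> linarith
  obtain ⟨c, hc⟩ : ∃ c : ℝ, c ^ 2 = 1 / 4 - y ^ 2 :=
    ⟨_, Real.sq_sqrt (by linarith)⟩
  let e : ι → F → ℝ := fun i k => if k = 0 then 0 else c * ε i k
  have he0 : ∀ i, e i 0 = 0 := fun i => by simp [e]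
  have hee : ∀ i k, e i (-k) = e i k := fun i k => by simp [e, heven]
  have hed : ∀ i k, diagProfile y k ^ 2 + e i k ^ 2 = diagProfile y k := by
    intro i k
    by_cases hk : k = 0
    · simp [e, diagProfile, hk]
    · have h : (quadraticChar F k : ℝ) ^ 2 = 1 := by exact_mod_cast quadraticChar_sq_one hk
      simp only [e, diagProfile, hk, if_false]
      linear_combination y ^ 2 * h + c ^ 2 * hsq i k + hc
  have hdd : ∀ i k, e i k * (diagProfile y k + diagProfile y (-k)) = e i k := by
    intro i k
    by_cases hk : k = 0
    · simp [e, hk]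
    · have h : quadraticChar F (-k) = - quadraticChar F k := by
        rw [← neg_one_mul, map_mul, hneg, neg_one_mul]
      simp only [diagProfile, hk, neg_eq_zero, if_false, h]
      push_cast
      ring
  have hcorr' : ∀ i j, i ≠ j → ∑ k, e i k * e j k = -2 * c ^ 2 := by
    intro i j hij
    have h : ∀ k, e i k * e j k = c ^ 2 * (ε i k * ε j k) - if k = 0 then c ^ 2 else 0 := by
      intro k
      by_cases hk : k = 0
      · simp [e, hk, hε0]
      · simp only [e, hk, if_false]
        ring
    simp only [h, sum_sub_distrib, ← mul_sum, hcorr i j hij, sum_ite_eq', mem_univ, if_true]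
    ring
  refine ⟨fun x => reflectionMatrix (diagProfile y) (e x.2) x.1,
    fun x => reflectionMatrix_mul_self (hee _) (hed _) (hdd _) _,
    fun x => reflectionMatrix_transpose (hee _) _,
    fun x => (trace_reflectionMatrix h2 (he0 _) _).trans (sum_diagProfile hF y), ?_⟩
  rintro ⟨s, i⟩ ⟨t, j⟩ hne
  have hq2 : q + 2 ≠ 0 := by positivity
  rw [trace_reflectionMatrix_mul h2 (he0 _) (he0 _) (hee _)]
  by_cases hst : s = t
  · subst hst
    have hij : i ≠ j := fun h => hne (by rw [h])
    have hshift := Equiv.sum_comp (Equiv.subRight s) fun k => diagProfile y k * diagProfile y k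
    simp only [Equiv.subRight_apply] at hshift
    rw [if_pos rfl, hcorr' i j hij, hshift, sum_diagProfile_mul_self hF, hc, ← hq, hy]
    field_simp
    ring
  · rw [if_neg hst, add_zero, sum_diagProfile_sub_mul hF hneg y hst, ← hq, hy]
    field_simp
    ring

end Packing

/-- Calderbank–Hardin–Rains–Shor–Sloane packing: for a prime
p ≡ 7 (mod 8) admitting a Hadamard matrix of order (p+1)/2, there exist p(p+1)/2 real
orthogonal projections of rank (p−1)/2 in M_p(ℂ), pairwise equiangular with
tr(P_i P_j) = (p²−5)/(4(p+2)), spanning the symmetric subspace S_p. -/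
theorem CHRSS_equiangular_projections
    (p : ℕ) (hp : p.Prime) (hmod : p % 8 = 7)
    (hH : ∃ H : Matrix (Fin ((p + 1) / 2)) (Fin ((p + 1) / 2)) ℝ,
      (∀ i j, H i j = 1 ∨ H i j = -1) ∧
      Hᵀ * H = (((p + 1) / 2 : ℕ) : ℝ) • (1 : Matrix (Fin ((p + 1) / 2)) (Fin ((p + 1) / 2)) ℝ)) :
    ∃ P : Fin (p * (p + 1) / 2) → Matrix (Fin p) (Fin p) ℝ,
      (∀ i, P i * P i = P i) ∧
      (∀ i, (P i)ᵀ = P i) ∧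
      (∀ i, (P i).rank = (p - 1) / 2) ∧
      (∀ i j, i ≠ j →
        Matrix.trace (P i * P j) = ((p : ℝ) ^ 2 - 5) / (4 * ((p : ℝ) + 2))) ∧
      Submodule.span ℂ (Set.range fun i => (P i).map Complex.ofReal) = symMatrices p := by
  classical
  obtain ⟨H, hH1, hHH⟩ := hH
  have : Fact p.Prime := ⟨hp⟩
  obtain ⟨π, hπ, hfold⟩ := exists_folding (p := p) (n := (p + 1) / 2) (by omega)
  have hsq : ∀ i j, H i j ^ 2 = 1 := fun i j => by
    rcases hH1 i j with h | h <;> simp [h]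
  have hchar : ringChar (ZMod p) ≠ 2 := by
    rw [ZMod.ringChar_zmod_n]
    omega
  have hneg : quadraticChar (ZMod p) (-1) = -1 := by
    rw [quadraticChar_neg_one_iff_not_isSquare, ZMod.exists_sq_eq_neg_one_iff]
    omega
  obtain ⟨P, hPP, hPt, hPtr, hPij⟩ := exists_equiangular_projections hchar hneg
    (fun j k => H (π 0) j * H (π k) j) (fun j k => by rw [mul_pow, hsq, hsq, one_mul])
    (fun j k => by simp only [hπ]) (fun j => by rw [← sq, hsq]) (by
      intro i j hij
      have h := congrFun (congrFun hHH i) j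
      simp only [Matrix.mul_apply, Matrix.transpose_apply, Matrix.smul_apply,
        Matrix.one_apply_ne hij, smul_zero] at h
      rw [hfold fun r => H (π 0) i * H r i * (H (π 0) j * H r j)]
      have h' : ∑ r, H (π 0) i * H r i * (H (π 0) j * H r j) =
          H (π 0) i * H (π 0) j * ∑ r, H r i * H r j := by
        rw [Finset.mul_sum]
        exact Finset.sum_congr rfl fun r _ => by ring
      rw [h', h]
      linear_combination -(H (π 0) j ^ 2) * hsq (π 0) i
        - hsq (π 0) j)
  rw [ZMod.card] at hPtr hPij
  have hcard : Fintype.card (Fin (p * (p + 1) / 2)) =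
      Fintype.card (ZMod p × Fin ((p + 1) / 2)) := by
    rw [Fintype.card_prod, ZMod.card, Fintype.card_fin, Fintype.card_fin]
    exact Nat.mul_div_assoc p (by omega)
  let g := Fintype.equivOfCardEq hcard
  let f : Fin p ≃ ZMod p := Fintype.equivOfCardEq (by rw [Fintype.card_fin, ZMod.card])
  let Q : Fin (p * (p + 1) / 2) → Matrix (Fin p) (Fin p) ℝ := fun i => (P (g i)).submatrix f f
  have htr : ∀ A : Matrix (ZMod p) (ZMod p) ℝ, (A.submatrix f f).trace = A.trace :=
    fun A => Equiv.sum_comp f fun k => A k k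
  have hQQ : ∀ i, Q i * Q i = Q i := fun i => by
    simp only [Q, Matrix.submatrix_mul_equiv, hPP]
  have hQt : ∀ i, (Q i)ᵀ = Q i := fun i => by
    simp only [Q, Matrix.transpose_submatrix, hPt]
  have hQtr : ∀ i, (Q i).trace = ((p : ℝ) - 1) / 2 := fun i => by
    simp only [Q, htr, hPtr]
  have hQij : ∀ i j, i ≠ j →
      (Q i * Q j).trace = ((p : ℝ) ^ 2 - 5) / (4 * ((p : ℝ) + 2)) := fun i j hij => by
    simp only [Q, Matrix.submatrix_mul_equiv, htr]
    exact hPij _ _ (g.injective.ne hij)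
  have hp7 : (7 : ℝ) ≤ p := by
    exact_mod_cast (by omega : 7 ≤ p)
  have hlin : LinearIndependent ℂ fun i => (Q i).map Complex.ofReal := by
    refine linearIndependent_of_trace_mul_eq Q
      (a := ((p : ℝ) - 1) / 2) (t := ((p : ℝ) ^ 2 - 5) / (4 * ((p : ℝ) + 2))) ?_ ?_ ?_
    · apply div_nonneg <;> nlinarith
    · rw [div_lt_div_iff₀ (by positivity) two_pos]
      nlinarith
    · intro i j
      split_ifs with h
      · rw [← h, hQQ, hQtr]
      · exact hQij i j h
  refine ⟨Q, hQQ, hQt, fun i => ?_, hQij, ?_⟩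
  · have h := (IsIdempotentElem.trace_eq_rank (hQQ i)).symm.trans (hQtr i)
    have h' : ((2 * (Q i).rank + 1 : ℕ) : ℝ) = p := by
      push_cast
      linarith
    have h'' : 2 * (Q i).rank + 1 = p := by exact_mod_cast h'
    omega
  · refine Submodule.eq_of_le_of_finrank_le ?_ ?_
    · rw [Submodule.span_le]
      rintro _ ⟨i, rfl⟩
      change ((Q i).map Complex.ofReal)ᵀ = (Q i).map Complex.ofReal
      rw [← Matrix.transpose_map, hQt]
    · rw [finrank_span_eq_card hlin, Fintype.card_fin]
      refine (finrank_symMatrices_le p).trans_eq ?_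
      rw [Nat.choose_two_right, Nat.add_sub_cancel, mul_comm]
end

section
/- Let p be a prime with p ≡ 7 (mod 8), suppose there exists a Hadamard matrix of order (p+1)/2, and set N = p(p+1)/2. Then the symmetric Werner–Holevo channel WH₊ on M_p(ℂ), defined by WH₊(X) = (tr(X)·I_p + Xᵀ)/(p+1), has mixed unitary rank N: (1) there exist nonnegative reals t_1, ..., t_N summing to 1 and unitary matrices U_1, ..., U_N ∈ M_p(ℂ) such that Σ_{j=1}^N t_j U_j X U_j* = (tr(X)·I_p + Xᵀ)/(p+1) for all X ∈ M_p(ℂ); and (2) for every k, every probability vector (s_1, ..., s_k) with all s_j > 0, and every choice of unitaries V_1, ..., V_k with Σ_{j=1}^k s_j V_j X V_j* = (tr(X)·I_p + Xᵀ)/(p+1) for all X, one has k ≥ N. -/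
open Matrix

open scoped ComplexConjugate

/-- A `±1` sequence on `ZMod p` with two-level autocorrelation, from the Legendre symbol. -/
lemma exists_sign_sequence (p : ℕ) [Fact p.Prime] (hp : p % 4 = 3) :
    ∃ f : ZMod p → ℝ, (∀ x, f x = 1 ∨ f x = -1) ∧ ∑ x, f x = 1 ∧
      ∀ d ≠ 0, ∑ x, f x * f (x + d) = -1 := by
  have hchar : ringChar (ZMod p) ≠ 2 := by
    rw [ZMod.ringChar_zmod_n]; omega
  have hneg : quadraticChar (ZMod p) (-1) = -1 := by
    rw [quadraticChar_neg_one_iff_not_isSquare, FiniteField.isSquare_neg_one_iff, ZMod.card]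
    simpa using hp
  have hcorr : ∀ d : ZMod p, d ≠ 0 →
      ∑ x, quadraticChar (ZMod p) x * quadraticChar (ZMod p) (x + d) = -1 := by
    intro d hd
    have hj := jacobiSum_nontrivial_inv (quadraticChar_ne_one hchar)
    rw [(quadraticChar_isQuadratic (ZMod p)).inv, hneg, jacobiSum] at hj
    have hd' : -d ≠ 0 := neg_ne_zero.mpr hd
    rw [← Equiv.sum_comp (Equiv.mulLeft₀ (-d) hd')]
    have : ∀ x, quadraticChar (ZMod p) (Equiv.mulLeft₀ (-d) hd' x) *
        quadraticChar (ZMod p) (Equiv.mulLeft₀ (-d) hd' x + d) =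
        -(quadraticChar (ZMod p) x * quadraticChar (ZMod p) (1 - x)) := by
      intro x
      have h1 : -d * x = -1 * (d * x) := by ring
      have h2 : -d * x + d = d * (1 - x) := by ring
      have h3 := quadraticChar_sq_one hd
      simp only [Equiv.mulLeft₀_apply]
      rw [h2, h1, map_mul, map_mul, map_mul, hneg]
      linear_combination (-(quadraticChar (ZMod p) x * quadraticChar (ZMod p) (1 - x))) * h3
    rw [Finset.sum_congr rfl fun x _ => this x, Finset.sum_neg_distrib, hj]
    norm_num
  have hodd : ∀ d : ZMod p, quadraticChar (ZMod p) (-d) = -quadraticChar (ZMod p) d := by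
    intro d
    rw [← neg_one_mul, map_mul, hneg, neg_one_mul]
  refine ⟨fun x => ((quadraticChar (ZMod p) x + if x = 0 then 1 else 0 : ℤ) : ℝ), ?_, ?_, ?_⟩
  · intro x
    by_cases hx : x = 0
    · simp [hx]
    · rcases quadraticChar_dichotomy hx with h | h <;> simp [hx, h]
  · rw [← Int.cast_sum, Finset.sum_add_distrib, quadraticChar_sum_zero hchar]
    simp
  · intro d hd
    have : ∑ x : ZMod p, (quadraticChar (ZMod p) x + if x = 0 then 1 else 0) *
        (quadraticChar (ZMod p) (x + d) + if x + d = 0 then 1 else 0) = -1 := by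
      simp only [add_mul, mul_add, Finset.sum_add_distrib, hcorr d hd, ite_mul, mul_ite,
        add_eq_zero_iff_eq_neg]
      have := hodd d
      simp only [quadraticChar_apply] at this
      simp [hd, this]
    simp only [← Int.cast_mul, ← Int.cast_sum]
    rw [this]
    norm_num

/-- A symmetric complex matrix, unitary up to the factor `√p`, with constant modulus on the
diagonal and constant modulus off the diagonal. -/
lemma exists_symmetric_two_modulus (m : ℕ) [Fact (2 * m + 1).Prime] (hp : (2 * m + 1) % 4 = 3) :
    ∃ T : ZMod (2 * m + 1) → ZMod (2 * m + 1) → ℂ,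
      (∀ i j, T i j = T j i) ∧ (∀ i, T i i * conj (T i i) = m + 1) ∧
      (∀ i j, i ≠ j → T i j * conj (T i j) = 1 / 2) ∧
      ∀ i k, ∑ j, T i j * conj (T k j) = if i = k then (2 * m + 1 : ℂ) else 0 := by
  obtain ⟨f, hf, hsum, hcorr⟩ := exists_sign_sequence (2 * m + 1) hp
  obtain ⟨α, β, γ, h1, h2, h3⟩ : ∃ α β γ : ℝ, α ^ 2 + γ ^ 2 = 1 / 2 ∧
      β ^ 2 + 2 * α * β = (2 * m + 1) / 2 ∧ (2 * m + 2) * α ^ 2 + 2 * α * β = 1 / 2 := by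
    have hm : (0 : ℝ) ≤ m := m.cast_nonneg
    have hr : (0 : ℝ) ≤ (2 * m) ^ 2 + (2 * m + 1) * (2 * m + 2) := by positivity
    set r := √((2 * m : ℝ) ^ 2 + (2 * m + 1) * (2 * m + 2)) with hrdef
    have hr2 : r ^ 2 = (2 * m : ℝ) ^ 2 + (2 * m + 1) * (2 * m + 2) := Real.sq_sqrt hr
    have hr0 : 0 ≤ r := Real.sqrt_nonneg _
    set s := 2 * m + r with hs
    have hs0 : 0 ≤ s := by positivity
    have hs2 : s ^ 2 - 4 * m * s = (2 * m + 1) * (2 * m + 2) := by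
      rw [hs]; linear_combination hr2
    set D : ℝ := 2 * (2 * m + 2 + 2 * s) with hD
    have hD1 : 1 ≤ D := by linarith
    have hα : (√(1 / D)) ^ 2 = 1 / D := Real.sq_sqrt (by positivity)
    have hγ : (√(1 / 2 - 1 / D)) ^ 2 = 1 / 2 - 1 / D := by
      apply Real.sq_sqrt
      rw [sub_nonneg]
      apply one_div_le_one_div_of_le <;> linarith
    have hD0 : D ≠ 0 := by positivity
    refine ⟨√(1 / D), s * √(1 / D), √(1 / 2 - 1 / D), by rw [hα, hγ]; ring, ?_, ?_⟩
    · have : (s * √(1 / D)) ^ 2 + 2 * √(1 / D) * (s * √(1 / D)) =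
        (s ^ 2 + 2 * s) * (√(1 / D)) ^ 2 := by ring
      rw [this, hα]
      field_simp
      rw [hD]; linear_combination 2 * hs2
    · have : (2 * m + 2) * √(1 / D) ^ 2 + 2 * √(1 / D) * (s * √(1 / D)) =
        (2 * m + 2 + 2 * s) * (√(1 / D)) ^ 2 := by ring
      rw [this, hα]
      field_simp
      rw [hD]; ring
  have hff : ∀ x, f x ^ 2 = 1 := fun x => by rcases hf x with h | h <;> rw [h] <;> norm_num
  have hsumK : ∀ i, ∑ j, f (i + j) = 1 := fun i => by
    rw [← hsum]; exact Equiv.sum_comp (Equiv.addLeft i) f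
  have hcorrK : ∀ i k, ∑ j, f (i + j) * f (k + j) =
      (2 * m + 2) * (if i = k then 1 else 0) - 1 := by
    intro i k
    split_ifs with h
    · subst h
      simp only [← sq, hff]
      simp; ring
    · have := hcorr (k - i) (sub_ne_zero.mpr (Ne.symm h))
      rw [← Equiv.sum_comp (Equiv.addLeft i)] at this
      simp only [Equiv.coe_addLeft] at this
      rw [mul_zero, zero_sub, ← this]
      refine Finset.sum_congr rfl fun j _ => ?_
      congr 2; ring
  have hI : (Complex.I : ℂ) ^ 2 = -1 := Complex.I_sq
  have c1 : (α : ℂ) ^ 2 + γ ^ 2 = 1 / 2 := by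
    have := congrArg Complex.ofReal h1; push_cast at this; exact this
  have c2 : (β : ℂ) ^ 2 + 2 * α * β = (2 * m + 1) / 2 := by
    have := congrArg Complex.ofReal h2; push_cast at this; exact this
  have c3 : (2 * m + 2) * (α : ℂ) ^ 2 + 2 * α * β = 1 / 2 := by
    have := congrArg Complex.ofReal h3; push_cast at this; exact this
  have cff : ∀ x, (f x : ℂ) ^ 2 = 1 := fun x => by exact_mod_cast congrArg Complex.ofReal (hff x)
  have csum : ∀ i, ∑ j, (f (i + j) : ℂ) = 1 := fun i => by
    exact_mod_cast congrArg Complex.ofReal (hsumK i)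
  have ccorr : ∀ i k, ∑ j, (f (i + j) : ℂ) * f (k + j) =
      (2 * m + 2) * (if i = k then 1 else 0) - 1 := fun i k => by
    have := congrArg Complex.ofReal (hcorrK i k)
    push_cast [apply_ite Complex.ofReal] at this
    exact this
  have hconj : ∀ i j, conj (Complex.I * (α + β * (if i = j then 1 else 0)) + γ * f (i + j)) =
      -Complex.I * (α + β * (if i = j then 1 else 0)) + γ * f (i + j) := by
    intro i j; split_ifs <;> simp
  refine ⟨fun i j => Complex.I * (α + β * (if i = j then 1 else 0)) + γ * f (i + j),
    ?_, ?_, ?_, ?_⟩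
  · intro i j
    simp only [add_comm i j, eq_comm (a := i)]
  · intro i
    rw [hconj]
    simp only [if_true]
    linear_combination (-(α + β : ℂ) ^ 2) * hI + (γ : ℂ) ^ 2 * cff (i + i) + c1 + c2
  · intro i j hij
    rw [hconj]
    simp only [hij, if_false]
    linear_combination (-(α : ℂ) ^ 2) * hI + (γ : ℂ) ^ 2 * cff (i + j) + c1
  · intro i k
    have expand : ∀ j, (Complex.I * (α + β * (if i = j then 1 else 0)) + γ * f (i + j)) *
        conj (Complex.I * (α + β * (if k = j then 1 else 0)) + γ * f (k + j)) =
        (α ^ 2 : ℂ) + α * β * (if i = j then 1 else 0) + α * β * (if k = j then 1 else 0) +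
        β ^ 2 * ((if i = j then 1 else 0) * (if k = j then 1 else 0)) +
        γ ^ 2 * (f (i + j) * f (k + j)) + Complex.I * γ * α * f (k + j) -
        Complex.I * γ * α * f (i + j) + Complex.I * γ * β * ((if i = j then 1 else 0) * f (k + j)) -
        Complex.I * γ * β * ((if k = j then 1 else 0) * f (i + j)) := by
      intro j
      rw [hconj]
      linear_combination (-(α + β * (if i = j then 1 else 0) : ℂ) *
        (α + β * (if k = j then 1 else 0))) * hI
    have d1 : ∑ j, (if i = j then 1 else 0 : ℂ) * (if k = j then 1 else 0) =
      if i = k then 1 else 0 := by simp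
    have d2 : ∀ i k : ZMod (2 * m + 1), ∑ j, (if i = j then 1 else 0 : ℂ) * f (k + j) = f (k + i) := by
      simp
    rw [Finset.sum_congr rfl fun j _ => expand j]
    simp only [Finset.sum_add_distrib, Finset.sum_sub_distrib, ← Finset.mul_sum, csum, ccorr, d1, d2]
    simp only [Finset.sum_const, Finset.card_univ, ZMod.card, Finset.sum_ite_eq, Finset.mem_univ,
      if_true, nsmul_eq_mul, add_comm i k]
    push_cast
    split_ifs
    · linear_combination c2 + (2 * m + 1) * c1
    · linear_combination c3 - c1

/-- The rows of a normalized Hadamard matrix, pulled back along `v ↦ ±v`. -/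
lemma exists_sign_rows (m : ℕ)
    (H : Matrix (Fin (m + 1)) (Fin (m + 1)) ℝ) (hH : ∀ i j, H i j = 1 ∨ H i j = -1)
    (hHH : Hᵀ * H = ((m + 1 : ℕ) : ℝ) • (1 : Matrix (Fin (m + 1)) (Fin (m + 1)) ℝ)) :
    ∃ g : Fin m → ZMod (2 * m + 1) → ℝ, (∀ k v, g k v = 1 ∨ g k v = -1) ∧
      (∀ v ≠ 0, ∑ k, g k v = -1) ∧
      ∀ v w, ∑ k, g k v * g k w = if v = w ∨ v = -w then (m : ℝ) else -1 := by
  let c : ZMod (2 * m + 1) → Fin (m + 1) := fun v =>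
    ⟨v.valMinAbs.natAbs, by have := ZMod.natAbs_valMinAbs_le v; omega⟩
  have hc : ∀ v w, c v = c w ↔ v = w ∨ v = -w := by
    intro v w
    simp only [c, Fin.mk.injEq]
    constructor
    · intro h
      rcases Int.natAbs_eq_natAbs_iff.mp h with h | h
      · left
        rw [← ZMod.coe_valMinAbs v, h, ZMod.coe_valMinAbs]
      · right
        rw [← ZMod.coe_valMinAbs v, h, Int.cast_neg, ZMod.coe_valMinAbs]
    · rintro (rfl | rfl)
      · rfl
      · exact ZMod.natAbs_valMinAbs_neg w
  have hsq : ∀ i j, H i j * H i j = 1 := fun i j => by rcases hH i j with h | h <;> simp [h]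
  have hcol : ∀ i j, ∑ k, H k i * H k j = if i = j then (m + 1 : ℝ) else 0 := by
    intro i j
    have := congrFun (congrFun hHH i) j
    simpa [Matrix.mul_apply, Matrix.one_apply] using this
  let G : Fin (m + 1) → ZMod (2 * m + 1) → ℝ := fun k v => H k (c v) * H k (c 0) *
    (H 0 (c v) * H 0 (c 0))
  have hG : ∀ v w, ∑ k, G k v * G k w = if v = w ∨ v = -w then (m + 1 : ℝ) else 0 := by
    intro v w
    have h1 : ∀ k, G k v * G k w = H 0 (c v) * H 0 (c w) * (H k (c v) * H k (c w)) := by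
      intro k
      simp only [G]
      linear_combination (H k (c v) * H k (c w) * H 0 (c v) * H 0 (c w)) *
        (H 0 (c 0) * H 0 (c 0) * hsq k (c 0) + hsq 0 (c 0))
    rw [Finset.sum_congr rfl fun k _ => h1 k, ← Finset.mul_sum, hcol]
    by_cases h : c v = c w
    · rw [if_pos h, if_pos ((hc v w).mp h), h, hsq, one_mul]
    · rw [if_neg h, if_neg (mt (hc v w).mpr h), mul_zero]
  have hG0 : ∀ v, G 0 v = 1 := fun v => by
    simp only [G]
    linear_combination (H 0 (c 0) * H 0 (c 0)) * hsq 0 (c v) + hsq 0 (c 0)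
  have hGz : ∀ k, G k 0 = 1 := fun k => by
    simp only [G]
    linear_combination (H k (c 0) * H k (c 0)) * hsq 0 (c 0) + hsq k (c 0)
  refine ⟨fun k v => G k.succ v, ?_, ?_, ?_⟩
  · intro k v
    simp only [G]
    rcases hH k.succ (c v) with h1 | h1 <;> rcases hH k.succ (c 0) with h2 | h2 <;>
      rcases hH 0 (c v) with h3 | h3 <;> rcases hH 0 (c 0) with h4 | h4 <;> simp [h1, h2, h3, h4]
  · intro v hv
    have := hG v 0
    rw [Fin.sum_univ_succ] at this
    simp only [hG0, hGz, mul_one, neg_zero, or_self, if_neg hv] at this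
    linarith
  · intro v w
    have := hG v w
    rw [Fin.sum_univ_succ, hG0, hG0] at this
    split_ifs at this ⊢ <;> linarith

/-- Completing a symmetric matrix `T` with two moduli by `m` families of unimodular entries, so
that along each anti-diagonal `a + b = c + d` the entries resolve the symmetric projection. -/
lemma exists_unimodular_completion (m : ℕ) [Fact (2 * m + 1).Prime] (hm : 0 < m)
    (T : ZMod (2 * m + 1) → ZMod (2 * m + 1) → ℂ) (hT : ∀ i j, T i j = T j i)
    (hTd : ∀ i, T i i * conj (T i i) = m + 1)
    (hTo : ∀ i j, i ≠ j → T i j * conj (T i j) = 1 / 2)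
    (g : Fin m → ZMod (2 * m + 1) → ℝ) (hg : ∀ k v, g k v = 1 ∨ g k v = -1)
    (hgs : ∀ v ≠ 0, ∑ k, g k v = -1)
    (hgg : ∀ v w, ∑ k, g k v * g k w = if v = w ∨ v = -w then (m : ℝ) else -1) :
    ∃ W : Fin m → ZMod (2 * m + 1) → ZMod (2 * m + 1) → ℂ,
      (∀ k i j, W k i j * conj (W k i j) = 1) ∧
      ∀ a b c d, a + b = c + d → T a b * conj (T c d) + ∑ k, W k a b * conj (W k c d) =
        (2 * m + 1 : ℂ) / 2 *
          ((if a = c ∧ b = d then 1 else 0) + if a = d ∧ b = c then 1 else 0) := by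
  have two : (2 : ZMod (2 * m + 1)) ≠ 0 := by
    have := ZMod.prime_ne_zero (2 * m + 1) 2 (by omega)
    exact_mod_cast this
  have half : ∀ x y : ZMod (2 * m + 1), x + x = y + y → x = y := fun x y h =>
    mul_left_cancel₀ two (by linear_combination h)
  have hM : ((m : ℂ) + 1) ≠ 0 := by exact_mod_cast (Nat.succ_ne_zero m)
  have hI : (Complex.I : ℂ) ^ 2 = -1 := Complex.I_sq
  obtain ⟨x, hx⟩ : ∃ x : ℝ, (x : ℂ) ^ 2 = 1 / (2 * (m + 1)) := by
    refine ⟨√(1 / (2 * (m + 1))), ?_⟩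
    rw [← Complex.ofReal_pow, Real.sq_sqrt (by positivity)]
    push_cast; rfl
  obtain ⟨y, hy⟩ : ∃ y : ℝ, (y : ℂ) ^ 2 = (2 * m + 1) / (2 * (m + 1)) := by
    refine ⟨√((2 * m + 1) / (2 * (m + 1))), ?_⟩
    rw [← Complex.ofReal_pow, Real.sq_sqrt (by positivity)]
    push_cast; rfl
  obtain ⟨r, hr⟩ : ∃ r : ℝ, (r : ℂ) ^ 2 = 2 := by
    refine ⟨√2, ?_⟩
    rw [← Complex.ofReal_pow, Real.sq_sqrt (by positivity)]
    push_cast; rfl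
  have hxy : (x : ℂ) ^ 2 + y ^ 2 = 1 := by rw [hx, hy]; field_simp; ring
  have hxy' : (m : ℂ) ^ 2 * x ^ 2 + y ^ 2 = (m + 1) / 2 := by rw [hx, hy]; field_simp; ring
  have cgs : ∀ v ≠ 0, ∑ k, (g k v : ℂ) = -1 := fun v hv => by
    exact_mod_cast congrArg Complex.ofReal (hgs v hv)
  have cgg : ∀ v w, ∑ k, (g k v : ℂ) * g k w = if v = w ∨ v = -w then (m : ℂ) else -1 :=
    fun v w => by
      have := congrArg Complex.ofReal (hgg v w)
      push_cast [apply_ite Complex.ofReal] at this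
      exact this
  have cg : ∀ k v, (g k v : ℂ) ^ 2 = 1 := fun k v => by
    rcases hg k v with h | h <;> simp [h]
  have off : ∀ k (i j : ZMod (2 * m + 1)), conj (r * T i j * (x + Complex.I * y * g k (i - j))) =
      r * conj (T i j) * (x - Complex.I * y * g k (i - j)) := by
    intro k i j
    simp only [map_mul, map_add, Complex.conj_ofReal, Complex.conj_I]
    ring
  have dia : ∀ i : ZMod (2 * m + 1), conj (-(r / (m + 1)) * (m * x - Complex.I * y) * T i i) =
      -(r / (m + 1)) * (m * x + Complex.I * y) * conj (T i i) := by
    intro i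
    simp only [map_mul, map_neg, map_div₀, map_sub, map_add, map_one, map_natCast,
      Complex.conj_ofReal, Complex.conj_I]
    ring
  refine ⟨fun k i j => if i = j then -(r / (m + 1)) * (m * x - Complex.I * y) * T i i else
    r * T i j * (x + Complex.I * y * g k (i - j)), ?_, ?_⟩
  · intro k i j
    by_cases h : i = j
    · simp only [if_pos h, dia]
      have e : (-(r / (m + 1)) * (m * x - Complex.I * y) * T i i) *
          (-(r / (m + 1)) * (m * x + Complex.I * y) * conj (T i i)) =
          (r : ℂ) ^ 2 / (m + 1) ^ 2 * (m ^ 2 * x ^ 2 - Complex.I ^ 2 * y ^ 2) *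
            (T i i * conj (T i i)) := by field_simp; ring
      rw [e, hTd, hr, hI, neg_one_mul, sub_neg_eq_add, hxy']
      field_simp
    · simp only [if_neg h, off]
      have e : (r * T i j * (x + Complex.I * y * g k (i - j))) *
          (r * conj (T i j) * (x - Complex.I * y * g k (i - j))) =
          (r : ℂ) ^ 2 * (x ^ 2 - Complex.I ^ 2 * y ^ 2 * (g k (i - j) : ℂ) ^ 2) *
            (T i j * conj (T i j)) := by ring
      rw [e, hTo i j h, hr, hI, cg]
      linear_combination hxy
  · have sum_sub : ∀ v ≠ 0, ∑ k, ((x : ℂ) - Complex.I * y * g k v) = m * x + Complex.I * y := by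
      intro v hv
      rw [Finset.sum_sub_distrib, ← Finset.mul_sum, cgs v hv]
      simp
    have sum_add : ∀ v ≠ 0, ∑ k, ((x : ℂ) + Complex.I * y * g k v) = m * x - Complex.I * y := by
      intro v hv
      rw [Finset.sum_add_distrib, ← Finset.mul_sum, cgs v hv]
      simp [sub_eq_add_neg]
    have key : (r / (m + 1) : ℂ) * (m * x - Complex.I * y) * (m * x + Complex.I * y) * r = 1 := by
      have e : (r / (m + 1) : ℂ) * (m * x - Complex.I * y) * (m * x + Complex.I * y) * r =
        (r : ℂ) ^ 2 / (m + 1) * (m ^ 2 * x ^ 2 - Complex.I ^ 2 * y ^ 2) := by ring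
      rw [e, hr, hI, neg_one_mul, sub_neg_eq_add, hxy']
      field_simp
    intro a b c d h
    by_cases hab : a = b <;> by_cases hcd : c = d
    · subst hab; subst hcd
      obtain rfl := half _ _ h
      simp only [if_true, dia, and_self]
      have e : (-(r / (m + 1)) * (m * x - Complex.I * y) * T a a) *
          (-(r / (m + 1)) * (m * x + Complex.I * y) * conj (T a a)) =
          ((r / (m + 1) : ℂ) * (m * x - Complex.I * y) * (m * x + Complex.I * y) * r) / (m + 1) *
            (T a a * conj (T a a)) := by ring
      rw [Finset.sum_const, e, key, hTd]
      simp only [Finset.card_univ, Fintype.card_fin, nsmul_eq_mul]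
      field_simp
      ring
    · subst hab
      have n1 : ¬(a = c ∧ a = d) := fun h => hcd (h.1.symm.trans h.2)
      have n2 : ¬(a = d ∧ a = c) := fun h => hcd (h.2.symm.trans h.1)
      simp only [if_true, if_neg hcd, if_neg n1, if_neg n2, off]
      have := sum_sub (c - d) (sub_ne_zero.mpr hcd)
      simp only [← Finset.mul_sum, this]
      linear_combination (-(T a a * conj (T c d))) * key
    · subst hcd
      have n1 : ¬(a = c ∧ b = c) := fun h => hab (h.1.trans h.2.symm)
      simp only [if_true, if_neg hab, if_neg n1, dia]
      have := sum_add (a - b) (sub_ne_zero.mpr hab)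
      simp only [← Finset.mul_sum, ← Finset.sum_mul, this]
      linear_combination (-(T a b * conj (T c c))) * key
    · simp only [if_neg hab, if_neg hcd, off]
      have e : ∀ k, (r * T a b * (x + Complex.I * y * g k (a - b))) *
          (r * conj (T c d) * (x - Complex.I * y * g k (c - d))) =
          2 * (T a b * conj (T c d)) * (x ^ 2 - Complex.I * y * x * g k (c - d) +
            Complex.I * y * x * g k (a - b) + y ^ 2 * (g k (a - b) * g k (c - d))) := by
        intro k
        linear_combination (T a b * conj (T c d) * (x + Complex.I * y * g k (a - b)) *
          (x - Complex.I * y * g k (c - d))) * hr - 2 * (T a b * conj (T c d)) * y ^ 2 *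
          (g k (a - b) * g k (c - d)) * hI
      rw [Finset.sum_congr rfl fun k _ => e k]
      simp only [← Finset.mul_sum, Finset.sum_add_distrib, Finset.sum_sub_distrib,
        cgs _ (sub_ne_zero.mpr hab), cgs _ (sub_ne_zero.mpr hcd), cgg]
      simp only [Finset.sum_const, Finset.card_univ, Fintype.card_fin, nsmul_eq_mul]
      have e1 : (m : ℂ) * x ^ 2 + y ^ 2 * m = m := by linear_combination (m : ℂ) * hxy
      have e2 : (m : ℂ) * x ^ 2 - y ^ 2 = -1 / 2 := by rw [hx, hy]; field_simp; ring
      by_cases h1 : a = c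
      · subst h1
        obtain rfl := add_left_cancel h
        have n2 : ¬(a = b ∧ b = a) := fun h => hab h.1
        rw [if_pos (Or.inl rfl), if_pos ⟨rfl, rfl⟩, if_neg n2, hTo a b hab]
        linear_combination e1
      · by_cases h2 : a = d
        · subst h2
          obtain rfl : b = c := by rw [add_comm c a] at h; exact add_left_cancel h
          have n2 : ¬(a = b ∧ b = a) := fun h => hab h.1
          rw [if_pos (Or.inr (by ring)), if_neg n2, if_pos ⟨rfl, rfl⟩, hT b a, hTo a b hab]
          linear_combination e1
        · have n0 : ¬(a - b = c - d ∨ a - b = -(c - d)) := by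
            rintro (h' | h')
            · exact h1 (half _ _ (by linear_combination h + h'))
            · exact h2 (half _ _ (by linear_combination h + h'))
          rw [if_neg n0, if_neg (fun h => h1 h.1), if_neg (fun h => h2 h.1)]
          linear_combination 2 * (T a b * conj (T c d)) * e2

/-- Unitary matrices indexed by `Fin (m + 1) × ZMod (2 * m + 1)` which, suitably normalized,
resolve the projection onto the symmetric tensors. -/
lemma exists_unitary_resolution (m : ℕ) [Fact (2 * m + 1).Prime] (hp : (2 * m + 1) % 4 = 3)
    (H : Matrix (Fin (m + 1)) (Fin (m + 1)) ℝ) (hH : ∀ i j, H i j = 1 ∨ H i j = -1)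
    (hHH : Hᵀ * H = ((m + 1 : ℕ) : ℝ) • (1 : Matrix (Fin (m + 1)) (Fin (m + 1)) ℝ)) :
    ∃ U : Fin (m + 1) × ZMod (2 * m + 1) → Matrix (ZMod (2 * m + 1)) (ZMod (2 * m + 1)) ℂ,
      (∀ j, U j * (U j)ᴴ = 1) ∧
      ∀ a b c d, ∑ j, U j a b * conj (U j c d) = (2 * m + 1 : ℂ) / 2 *
        ((if a = c ∧ b = d then 1 else 0) + if a = d ∧ b = c then 1 else 0) := by
  obtain ⟨T, hT, hTd, hTo, hTT⟩ := exists_symmetric_two_modulus m hp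
  obtain ⟨g, hg, hgs, hgg⟩ := exists_sign_rows m H hH hHH
  obtain ⟨W, hW, hWT⟩ := exists_unimodular_completion m (by omega) T hT hTd hTo g hg hgs hgg
  let ψ : AddChar (ZMod (2 * m + 1)) ℂ := ZMod.stdAddChar
  have hP : (2 * m + 1 : ℂ) ≠ 0 := by exact_mod_cast (Nat.succ_ne_zero (2 * m))
  obtain ⟨q, hq⟩ : ∃ q : ℝ, (q : ℂ) ^ 2 = 1 / (2 * m + 1) := by
    refine ⟨√(1 / (2 * m + 1)), ?_⟩
    rw [← Complex.ofReal_pow, Real.sq_sqrt (by positivity)]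
    push_cast; rfl
  have hψ : ∀ u v, ψ u * conj (ψ v) = ψ (u - v) := fun u v => by
    rw [← AddChar.map_neg_eq_conj, ← AddChar.map_add_eq_mul, sub_eq_add_neg]
  let A : ZMod (2 * m + 1) → Matrix (ZMod (2 * m + 1)) (ZMod (2 * m + 1)) ℂ :=
    fun s i j => q * ψ (s * (i + j)) * T i j
  let B : Fin m → ZMod (2 * m + 1) → Matrix (ZMod (2 * m + 1)) (ZMod (2 * m + 1)) ℂ :=
    fun k s i j => if i + j = s then W k i j else 0
  have hB : ∀ k s i j, B k s i j = if i + j = s then W k i j else 0 := fun _ _ _ _ => rfl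
  have hA : ∀ s i j i' j', A s i j * conj (A s i' j') =
      1 / (2 * m + 1) * (T i j * conj (T i' j')) * ψ (s * (i + j - (i' + j'))) := by
    intro s i j i' j'
    simp only [A, map_mul, Complex.conj_ofReal]
    rw [mul_sub, ← hψ, ← hq]
    ring
  refine ⟨fun t => Fin.cases (A t.2) (fun k => B k t.2) t.1, ?_, ?_⟩
  · rintro ⟨k, s⟩
    induction k using Fin.cases with
    | zero =>
      ext i k
      simp only [Fin.cases_zero, Matrix.mul_apply, Matrix.conjTranspose_apply, Matrix.one_apply,
        ← starRingEnd_apply, hA, add_sub_add_right_eq_sub]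
      rw [← Finset.sum_mul, ← Finset.mul_sum, hTT]
      split_ifs with h
      · subst h
        simp [hP]
      · simp
    | succ k =>
      ext i l
      simp only [Fin.cases_succ, Matrix.mul_apply, Matrix.conjTranspose_apply, Matrix.one_apply,
        ← starRingEnd_apply, hB]
      rw [Finset.sum_eq_single (s - i)]
      · simp only [add_sub_cancel, if_true]
        split_ifs with h1 h2 h2
        · subst h2; exact hW k i _
        · exact absurd (by linear_combination -h1) h2
        · exact absurd (by rw [← h2]; ring) h1
        · simp
      · intro j _ hj
        rw [if_neg (fun h => hj (by rw [← h]; ring)), zero_mul]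
      · simp
  · intro a b c d
    rw [Fintype.sum_prod_type, Fin.sum_univ_succ]
    simp only [Fin.cases_zero, Fin.cases_succ, hA]
    rw [← Finset.mul_sum, AddChar.sum_mulShift _ (ZMod.isPrimitive_stdAddChar _)]
    by_cases h : a + b = c + d
    · rw [if_pos (sub_eq_zero.mpr h), ← hWT a b c d h]
      congr 1
      · rw [ZMod.card]; push_cast; field_simp
      · refine Finset.sum_congr rfl fun k _ => ?_
        rw [Finset.sum_eq_single (a + b)]
        · simp [hB, h]
        · intro s _ hs
          simp [hB, Ne.symm hs]
        · simp
    · rw [if_neg (sub_ne_zero.mpr h), if_neg, if_neg]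
      · have : ∀ k s, B k s a b * conj (B k s c d) = 0 := by
          intro k s
          simp only [hB]
          split_ifs with h1 h2
          · exact absurd (h1.trans h2.symm) h
          all_goals simp
        simp [this]
      · rintro ⟨rfl, rfl⟩; exact h (add_comm _ _)
      · rintro ⟨rfl, rfl⟩; exact h rfl

/-- Entrywise form of the Kraus identity for the symmetric Werner–Holevo channel. -/
lemma kraus_sum_eq_iff {ι κ : Type*} [Fintype ι] [Fintype κ] [DecidableEq κ] (c : ℂ) (s : ι → ℂ)
    (V : ι → Matrix κ κ ℂ) :
    (∀ X : Matrix κ κ ℂ, ∑ j, s j • (V j * X * (V j)ᴴ) = c • (Matrix.trace X • 1 + Xᵀ)) ↔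
      ∀ i b k d, ∑ j, s j * (V j i b * conj (V j k d)) =
        c * ((if i = k ∧ b = d then 1 else 0) + if i = d ∧ b = k then 1 else 0) := by
  have expand : ∀ (j : ι) (X : Matrix κ κ ℂ) (i k : κ),
      (V j * X * (V j)ᴴ) i k = ∑ d, ∑ b, X b d * (V j i b * conj (V j k d)) := by
    intro j X i k
    simp only [Matrix.mul_apply, Matrix.conjTranspose_apply, Finset.sum_mul, ← starRingEnd_apply]
    exact Finset.sum_congr rfl fun d _ => Finset.sum_congr rfl fun b _ => by ring
  constructor
  · intro h i b k d
    have := congrFun (congrFun (h (Matrix.single b d 1)) i) k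
    simp only [Matrix.sum_apply, Matrix.smul_apply, expand, smul_eq_mul, Matrix.add_apply,
      Matrix.transpose_apply, Matrix.one_apply, Matrix.single_apply, ite_mul, one_mul, zero_mul] at this
    have e : ∀ j, ∑ d', ∑ b', (if b = b' ∧ d = d' then V j i b' * conj (V j k d') else 0) =
        V j i b * conj (V j k d) := by
      intro j
      simp [ite_and]
    simp only [e] at this
    rw [this]
    congr 2
    · by_cases hbd : b = d
      · subst hbd; simp
      · simp [Matrix.trace, hbd]
    · simp only [and_comm, eq_comm]
  · intro h X
    ext i k
    simp only [Matrix.sum_apply, Matrix.smul_apply, expand, smul_eq_mul, Matrix.add_apply,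
      Matrix.transpose_apply, Matrix.one_apply, Finset.mul_sum]
    rw [Finset.sum_comm]
    have e : ∀ d, ∑ j, ∑ b, s j * (X b d * (V j i b * conj (V j k d))) =
        ∑ b, X b d * (c * ((if i = k ∧ b = d then 1 else 0) + if i = d ∧ b = k then 1 else 0)) := by
      intro d
      rw [Finset.sum_comm]
      refine Finset.sum_congr rfl fun b _ => ?_
      rw [← h, Finset.mul_sum]
      exact Finset.sum_congr rfl fun j _ => by ring
    simp only [e, mul_add, Finset.sum_add_distrib]
    congr 1
    · by_cases hik : i = k
      · simp [hik, Matrix.trace, Finset.mul_sum, mul_comm]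
      · simp [hik]
    · simp [ite_and, mul_comm]

/-- A Kraus representation of the symmetric Werner–Holevo channel has at least as many terms as
the dimension of the space of symmetric matrices. -/
lemma card_sym2_le_of_kraus_sum {ι κ : Type*} [Fintype ι] [Fintype κ] [DecidableEq κ]
    (c : ℂ) (hc : c ≠ 0) (s : ι → ℂ) (V : ι → Matrix κ κ ℂ)
    (h : ∀ i b k d, ∑ j, s j * (V j i b * conj (V j k d)) =
        c * ((if i = k ∧ b = d then 1 else 0) + if i = d ∧ b = k then 1 else 0)) :
    Fintype.card (Sym2 κ) ≤ Fintype.card ι := by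
  classical
  let u : Sym2 κ → κ × κ := Quot.out
  have hu : ∀ z, s((u z).1, (u z).2) = z := fun z => Quot.out_eq z
  let P : Matrix (Sym2 κ) ι ℂ := fun z j => s j * V j (u z).1 (u z).2
  let Q : Matrix ι (Sym2 κ) ℂ := fun j z => conj (V j (u z).1 (u z).2)
  have hP : ∀ z j, P z j = s j * V j (u z).1 (u z).2 := fun _ _ => rfl
  have hQ : ∀ j z, Q j z = conj (V j (u z).1 (u z).2) := fun _ _ => rfl
  let w : Sym2 κ → ℂ := fun z => c * (1 + if (u z).1 = (u z).2 then 1 else 0)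
  have hw : ∀ z, w z ≠ 0 := by
    intro z
    refine mul_ne_zero hc ?_
    split_ifs <;> norm_num
  have hPQ : P * Q = Matrix.diagonal w := by
    ext z z'
    have e := h (u z).1 (u z).2 (u z').1 (u z').2
    simp only [Matrix.mul_apply, hP, hQ, Matrix.diagonal_apply, mul_assoc, e, w]
    by_cases hz : z = z'
    · subst hz
      simp [eq_comm]
    · rw [if_neg hz, if_neg, if_neg]
      · simp
      · rintro ⟨h1, h2⟩
        exact hz (by rw [← hu z, ← hu z', h1, h2, Sym2.eq_swap])
      · rintro ⟨h1, h2⟩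
        exact hz (by rw [← hu z, ← hu z', h1, h2])
  have hrank := Matrix.rank_mul_le_left P Q
  rw [hPQ, Matrix.rank_diagonal] at hrank
  have := hrank.trans (Matrix.rank_le_card_width P)
  simpa [hw] using this

/-- for a prime p ≡ 7 (mod 8) admitting a Hadamard matrix of order
(p+1)/2, the symmetric Werner–Holevo channel WH₊(X) = (tr(X)·I + Xᵀ)/(p+1) on M_p(ℂ)
has mixed unitary rank N = p(p+1)/2: it is a mixture of N unitary conjugations, and
any mixing with strictly positive weights uses at least N unitaries. -/
theorem werner_holevo_mixed_unitary_rank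
    (p : ℕ) (hp : p.Prime) (hmod : p % 8 = 7)
    (hH : ∃ H : Matrix (Fin ((p + 1) / 2)) (Fin ((p + 1) / 2)) ℝ,
      (∀ i j, H i j = 1 ∨ H i j = -1) ∧
      Hᵀ * H = (((p + 1) / 2 : ℕ) : ℝ) • (1 : Matrix (Fin ((p + 1) / 2)) (Fin ((p + 1) / 2)) ℝ)) :
    (∃ t : Fin (p * (p + 1) / 2) → ℝ, ∃ U : Fin (p * (p + 1) / 2) → Matrix (Fin p) (Fin p) ℂ,
      (∀ j, 0 ≤ t j) ∧ (∑ j, t j = 1) ∧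
      (∀ j, U j ∈ Matrix.unitaryGroup (Fin p) ℂ) ∧
      (∀ X : Matrix (Fin p) (Fin p) ℂ,
        ∑ j, (t j : ℂ) • (U j * X * (U j)ᴴ)
          = ((p : ℂ) + 1)⁻¹ • (Matrix.trace X • (1 : Matrix (Fin p) (Fin p) ℂ) + Xᵀ))) ∧
    (∀ (k : ℕ) (s : Fin k → ℝ) (V : Fin k → Matrix (Fin p) (Fin p) ℂ),
      (∀ j, 0 < s j) → (∑ j, s j = 1) →
      (∀ j, V j ∈ Matrix.unitaryGroup (Fin p) ℂ) →
      (∀ X : Matrix (Fin p) (Fin p) ℂ,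
        ∑ j, (s j : ℂ) • (V j * X * (V j)ᴴ)
          = ((p : ℂ) + 1)⁻¹ • (Matrix.trace X • (1 : Matrix (Fin p) (Fin p) ℂ) + Xᵀ)) →
      p * (p + 1) / 2 ≤ k) := by
  obtain ⟨H, hH, hHH⟩ := hH
  have : Fact p.Prime := ⟨hp⟩
  have hcard : Fintype.card (Sym2 (Fin p)) = p * (p + 1) / 2 := by
    rw [Sym2.card, Fintype.card_fin, Nat.choose_two_right, Nat.add_sub_cancel, mul_comm]
  have hp1 : ((p : ℂ) + 1) ≠ 0 := by exact_mod_cast Nat.succ_ne_zero p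
  refine ⟨?_, ?_⟩
  · obtain ⟨m, hm⟩ : ∃ m, p = 2 * m + 1 := ⟨p / 2, by omega⟩
    subst hm
    have hn : (2 * m + 1 + 1) / 2 = m + 1 := by omega
    have hN : (2 * m + 1) * (2 * m + 1 + 1) / 2 = (m + 1) * (2 * m + 1) := by
      apply Nat.div_eq_of_eq_mul_left two_pos; ring
    rw [hN]
    generalize (2 * m + 1 + 1) / 2 = n at hn H
    subst hn
    obtain ⟨U, hU, hUU⟩ := exists_unitary_resolution m (by omega) H hH hHH
    have hcardι : Fintype.card (Fin ((m + 1) * (2 * m + 1))) =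
        Fintype.card (Fin (m + 1) × ZMod (2 * m + 1)) := by
      simp [ZMod.card]
    let e := Fintype.equivOfCardEq hcardι
    let φ : Fin (2 * m + 1) ≃ ZMod (2 * m + 1) := (ZMod.finEquiv (2 * m + 1)).toEquiv
    refine ⟨fun _ => 1 / ((m + 1) * (2 * m + 1)), fun j => (U (e j)).submatrix φ φ, ?_, ?_, ?_, ?_⟩
    · intro j; positivity
    · have : ((m : ℝ) + 1) * (2 * m + 1) ≠ 0 := by positivity
      simp only [Finset.sum_const, Finset.card_univ, Fintype.card_fin, nsmul_eq_mul]
      push_cast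
      field_simp
    · intro j
      rw [Matrix.mem_unitaryGroup_iff, Matrix.star_eq_conjTranspose, Matrix.conjTranspose_submatrix,
        Matrix.submatrix_mul_equiv, hU, Matrix.submatrix_one_equiv]
    · rw [kraus_sum_eq_iff (((2 * m + 1 : ℕ) : ℂ) + 1)⁻¹]
      intro i b k d
      rw [← Finset.mul_sum]
      simp only [Matrix.submatrix_apply]
      rw [Equiv.sum_comp e (fun t => U t (φ i) (φ b) * conj (U t (φ k) (φ d))), hUU]
      simp only [EmbeddingLike.apply_eq_iff_eq]
      rw [← mul_assoc]
      congr 1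
      have h1 : (m : ℂ) + 1 ≠ 0 := by exact_mod_cast Nat.succ_ne_zero m
      have h2 : (m * 2 + 1 : ℂ) ≠ 0 := by exact_mod_cast Nat.succ_ne_zero (m * 2)
      have h3 : (((2 * m + 1 : ℕ) : ℂ) + 1) = 2 * (m + 1) := by push_cast; ring
      rw [h3]
      push_cast
      field_simp
  · intro k s V _ _ _ h
    rw [← hcard]
    have := card_sym2_le_of_kraus_sum _ (inv_ne_zero hp1) (fun j => (s j : ℂ)) V
      ((kraus_sum_eq_iff _ _ _).mp h)
    simpa using this
end
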